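/- Let T be a commutative ternary Γ-semiring and (I_α)_{α ∈ (0,1]} a family of Γ-ideals of T such that I_β ⊆ I_α whenever α ≤ β. Then the function μ : T → [0,1] defined by μ(a) = sup{α ∈ (0,1] : a ∈ I_α} (with sup of the empty set taken to be 0) is a fuzzy Γ-ideal of T. -/

import Mathlib

/-- A commutative ternary Γ-semiring: a commutative additive monoid `T` with a
Γ-indexed family of ternary operations satisfying distributivity in each argument,
absorption by `0`, ternary associativity, and invariance under all permutations
of the three arguments (generated by the two adjacent transpositions). -/
structure TernaryGammaSemiring (T : Type*) (Γ : Type*) [AddCommMonoid T] where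
  tmul : Γ → T → T → T → T
  distrib₁ : ∀ (γ : Γ) (a b c d : T), tmul γ (a + b) c d = tmul γ a c d + tmul γ b c d
  distrib₂ : ∀ (γ : Γ) (a b c d : T), tmul γ a (b + c) d = tmul γ a b d + tmul γ a c d
  distrib₃ : ∀ (γ : Γ) (a b c d : T), tmul γ a b (c + d) = tmul γ a b c + tmul γ a b d
  zero₁ : ∀ (γ : Γ) (a b : T), tmul γ 0 a b = 0
  zero₂ : ∀ (γ : Γ) (a b : T), tmul γ a 0 b = 0
  zero₃ : ∀ (γ : Γ) (a b : T), tmul γ a b 0 = 0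
  assoc : ∀ (α β : Γ) (a b c d e : T),
    tmul β (tmul α a b c) d e = tmul α a b (tmul β c d e)
  comm₁₂ : ∀ (γ : Γ) (a b c : T), tmul γ a b c = tmul γ b a c
  comm₂₃ : ∀ (γ : Γ) (a b c : T), tmul γ a b c = tmul γ a c b

variable {T Γ : Type*} [AddCommMonoid T]

/-- A Γ-ideal: an additive submonoid absorbing ternary multiplication. -/
def IsGammaIdeal (S : TernaryGammaSemiring T Γ) (I : Set T) : Prop :=
  (0 : T) ∈ I ∧ (∀ a ∈ I, ∀ b ∈ I, a + b ∈ I) ∧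
    ∀ (x y : T) (γ : Γ), ∀ a ∈ I, S.tmul γ x y a ∈ I

/-- A prime Γ-ideal. -/
def IsPrimeGammaIdeal (S : TernaryGammaSemiring T Γ) (P : Set T) : Prop :=
  IsGammaIdeal S P ∧ P ≠ Set.univ ∧
    ∀ (a b c : T) (γ : Γ), S.tmul γ a b c ∈ P → a ∈ P ∨ b ∈ P ∨ c ∈ P

/-- `Rad(T)`: the intersection of all prime Γ-ideals. -/
def GammaRad (S : TernaryGammaSemiring T Γ) : Set T :=
  {x | ∀ P : Set T, IsPrimeGammaIdeal S P → x ∈ P}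

/-- A Γ-congruence. -/
def IsGammaCong (S : TernaryGammaSemiring T Γ) (ρ : T → T → Prop) : Prop :=
  Equivalence ρ ∧ (∀ a b c d : T, ρ a b → ρ c d → ρ (a + c) (b + d)) ∧
    ∀ (γ : Γ) (a b c d e f : T), ρ a b → ρ c d → ρ e f →
      ρ (S.tmul γ a c e) (S.tmul γ b d f)

/-- The additive congruence underlying a Γ-congruence. -/
def congAddCon (S : TernaryGammaSemiring T Γ) (ρ : T → T → Prop)
    (h : IsGammaCong S ρ) : AddCon T :=
  ⟨⟨ρ, h.1⟩, fun hab hcd => h.2.1 _ _ _ _ hab hcd⟩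

/-- The induced ternary operations on the quotient. -/
def quotTmul (S : TernaryGammaSemiring T Γ) (ρ : T → T → Prop) (h : IsGammaCong S ρ)
    (γ : Γ) (x y z : (congAddCon S ρ h).Quotient) : (congAddCon S ρ h).Quotient :=
  Quotient.liftOn₂ x y
    (fun a b => Quotient.liftOn z
      (fun c => (↑(S.tmul γ a b c) : (congAddCon S ρ h).Quotient))
      (fun c₁ c₂ hc => Quotient.sound (h.2.2 γ a a b b c₁ c₂ (h.1.refl a) (h.1.refl b) hc)))
    (fun a₁ b₁ a₂ b₂ ha hb => by
      refine Quotient.inductionOn z (fun c => ?_)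
      exact Quotient.sound (h.2.2 γ a₁ a₂ b₁ b₂ c c ha hb (h.1.refl c)))

/-- The quotient of a commutative ternary Γ-semiring by a Γ-congruence. -/
def quotTGS (S : TernaryGammaSemiring T Γ) (ρ : T → T → Prop) (h : IsGammaCong S ρ) :
    TernaryGammaSemiring (congAddCon S ρ h).Quotient Γ where
  tmul := quotTmul S ρ h
  distrib₁ := by
    rintro γ ⟨a⟩ ⟨b⟩ ⟨c⟩ ⟨d⟩
    show (↑(S.tmul γ (a + b) c d) : (congAddCon S ρ h).Quotient)
      = ↑(S.tmul γ a c d + S.tmul γ b c d)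
    rw [S.distrib₁]
  distrib₂ := by
    rintro γ ⟨a⟩ ⟨b⟩ ⟨c⟩ ⟨d⟩
    show (↑(S.tmul γ a (b + c) d) : (congAddCon S ρ h).Quotient)
      = ↑(S.tmul γ a b d + S.tmul γ a c d)
    rw [S.distrib₂]
  distrib₃ := by
    rintro γ ⟨a⟩ ⟨b⟩ ⟨c⟩ ⟨d⟩
    show (↑(S.tmul γ a b (c + d)) : (congAddCon S ρ h).Quotient)
      = ↑(S.tmul γ a b c + S.tmul γ a b d)
    rw [S.distrib₃]
  zero₁ := by
    rintro γ ⟨a⟩ ⟨b⟩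
    show (↑(S.tmul γ 0 a b) : (congAddCon S ρ h).Quotient) = ↑(0 : T)
    rw [S.zero₁]
  zero₂ := by
    rintro γ ⟨a⟩ ⟨b⟩
    show (↑(S.tmul γ a 0 b) : (congAddCon S ρ h).Quotient) = ↑(0 : T)
    rw [S.zero₂]
  zero₃ := by
    rintro γ ⟨a⟩ ⟨b⟩
    show (↑(S.tmul γ a b 0) : (congAddCon S ρ h).Quotient) = ↑(0 : T)
    rw [S.zero₃]
  assoc := by
    rintro α β ⟨a⟩ ⟨b⟩ ⟨c⟩ ⟨d⟩ ⟨e⟩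
    show (↑(S.tmul β (S.tmul α a b c) d e) : (congAddCon S ρ h).Quotient)
      = ↑(S.tmul α a b (S.tmul β c d e))
    rw [S.assoc]
  comm₁₂ := by
    rintro γ ⟨a⟩ ⟨b⟩ ⟨c⟩
    show (↑(S.tmul γ a b c) : (congAddCon S ρ h).Quotient) = ↑(S.tmul γ b a c)
    rw [S.comm₁₂]
  comm₂₃ := by
    rintro γ ⟨a⟩ ⟨b⟩ ⟨c⟩
    show (↑(S.tmul γ a b c) : (congAddCon S ρ h).Quotient) = ↑(S.tmul γ a c b)
    rw [S.comm₂₃]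

/-- The chain of left-iterated products witnessing nilpotency:
`t 0 = {x,x,a 0}_{γ 0}`, `t (k+1) = {t k, x, a (k+1)}_{γ (k+1)}`. -/
def nilpChain (S : TernaryGammaSemiring T Γ) (x : T) (γ : ℕ → Γ) (a : ℕ → T) : ℕ → T
  | 0 => S.tmul (γ 0) x x (a 0)
  | k + 1 => S.tmul (γ (k + 1)) (nilpChain S x γ a k) x (a (k + 1))

/-- `x` is nilpotent: some left-iterated product starting from `{x,x,a₁}` vanishes. -/
def IsGammaNilpotent (S : TernaryGammaSemiring T Γ) (x : T) : Prop :=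
  ∃ (γ : ℕ → Γ) (a : ℕ → T) (k : ℕ), nilpChain S x γ a k = 0

/-- `Nil(T)`: the set of nilpotent elements. -/
def GammaNil (S : TernaryGammaSemiring T Γ) : Set T :=
  {x | IsGammaNilpotent S x}

/-- A Γ-homomorphism between commutative ternary Γ-semirings over the same Γ. -/
def IsGammaHom {T' : Type*} [AddCommMonoid T']
    (S : TernaryGammaSemiring T Γ) (S' : TernaryGammaSemiring T' Γ) (f : T → T') : Prop :=
  f 0 = 0 ∧ (∀ a b : T, f (a + b) = f a + f b) ∧
    ∀ (γ : Γ) (a b c : T), f (S.tmul γ a b c) = S'.tmul γ (f a) (f b) (f c)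

/-- The Bourne relation attached to a Γ-ideal `I`:
`a ≡ b` iff `a + i = b + j` for some `i, j ∈ I`. -/
def bourneRel (I : Set T) : T → T → Prop :=
  fun a b => ∃ i ∈ I, ∃ j ∈ I, a + i = b + j

/-- The Bourne relation of a Γ-ideal is a Γ-congruence. -/
theorem bourneRel_isGammaCong (S : TernaryGammaSemiring T Γ) (I : Set T)
    (hI : IsGammaIdeal S I) : IsGammaCong S (bourneRel I) := by
  obtain ⟨h0, hadd, hmul⟩ := hI
  have tmul_mem : ∀ (γ : Γ) (x y : T), ∀ a ∈ I, S.tmul γ x a y ∈ I := by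
    intro γ x y a ha
    have := hmul x y γ a ha
    rwa [S.comm₂₃] at this
  refine ⟨⟨fun a => ⟨0, h0, 0, h0, rfl⟩, ?_, ?_⟩, ?_, ?_⟩
  · rintro a b ⟨i, hi, j, hj, hij⟩
    exact ⟨j, hj, i, hi, hij.symm⟩
  · rintro a b c ⟨i, hi, j, hj, hij⟩ ⟨i', hi', j', hj', hij'⟩
    refine ⟨i + i', hadd _ hi _ hi', j' + j, hadd _ hj' _ hj, ?_⟩
    calc a + (i + i') = a + i + i' := by rw [add_assoc]
      _ = b + j + i' := by rw [hij]
      _ = b + i' + j := by rw [add_assoc, add_comm j i', ← add_assoc]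
      _ = c + j' + j := by rw [hij']
      _ = c + (j' + j) := by rw [add_assoc]
  · rintro a b c d ⟨i, hi, j, hj, hij⟩ ⟨i', hi', j', hj', hij'⟩
    refine ⟨i + i', hadd _ hi _ hi', j + j', hadd _ hj _ hj', ?_⟩
    calc a + c + (i + i') = (a + i) + (c + i') := by
          rw [add_add_add_comm]
      _ = (b + j) + (d + j') := by rw [hij, hij']
      _ = b + d + (j + j') := by rw [add_add_add_comm]
  · rintro γ a b c d e f ⟨i, hi, j, hj, hij⟩ ⟨i', hi', j', hj', hij'⟩ ⟨i'', hi'', j'', hj'', hij''⟩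
    refine ⟨S.tmul γ i c e + (S.tmul γ b i' e + S.tmul γ b d i''),
      hadd _ (by rw [S.comm₁₂, S.comm₂₃]; exact hmul c e γ i hi) _
        (hadd _ (tmul_mem γ b e i' hi') _ (hmul b d γ i'' hi'')),
      S.tmul γ j c e + (S.tmul γ b j' e + S.tmul γ b d j''),
      hadd _ (by rw [S.comm₁₂, S.comm₂₃]; exact hmul c e γ j hj) _
        (hadd _ (tmul_mem γ b e j' hj') _ (hmul b d γ j'' hj'')), ?_⟩
    have e₁ : S.tmul γ a c e + S.tmul γ i c e = S.tmul γ b c e + S.tmul γ j c e := by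
      rw [← S.distrib₁, ← S.distrib₁, hij]
    have e₂ : S.tmul γ b c e + S.tmul γ b i' e = S.tmul γ b d e + S.tmul γ b j' e := by
      rw [← S.distrib₂, ← S.distrib₂, hij']
    have e₃ : S.tmul γ b d e + S.tmul γ b d i'' = S.tmul γ b d f + S.tmul γ b d j'' := by
      rw [← S.distrib₃, ← S.distrib₃, hij'']
    calc S.tmul γ a c e + (S.tmul γ i c e + (S.tmul γ b i' e + S.tmul γ b d i''))
        = (S.tmul γ a c e + S.tmul γ i c e) + (S.tmul γ b i' e + S.tmul γ b d i'') := by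
          rw [← add_assoc]
      _ = (S.tmul γ b c e + S.tmul γ j c e) + (S.tmul γ b i' e + S.tmul γ b d i'') := by
          rw [e₁]
      _ = ((S.tmul γ b c e + S.tmul γ b i' e) + S.tmul γ b d i'') + S.tmul γ j c e := by
          abel
      _ = ((S.tmul γ b d e + S.tmul γ b j' e) + S.tmul γ b d i'') + S.tmul γ j c e := by
          rw [e₂]
      _ = ((S.tmul γ b d e + S.tmul γ b d i'') + S.tmul γ b j' e) + S.tmul γ j c e := by
          abel
      _ = ((S.tmul γ b d f + S.tmul γ b d j'') + S.tmul γ b j' e) + S.tmul γ j c e := by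
          rw [e₃]
      _ = S.tmul γ b d f + (S.tmul γ j c e + (S.tmul γ b j' e + S.tmul γ b d j'')) := by
          abel

/-- `Rad(T)` is a Γ-ideal. -/
theorem gammaRad_isGammaIdeal (S : TernaryGammaSemiring T Γ) :
    IsGammaIdeal S (GammaRad S) := by
  refine ⟨fun P hP => hP.1.1, ?_, ?_⟩
  · intro a ha b hb P hP
    exact hP.1.2.1 _ (ha P hP) _ (hb P hP)
  · intro x y γ a ha P hP
    exact hP.1.2.2 x y γ a (ha P hP)

/-- The quotient of `T` by the Bourne congruence of the Γ-ideal `Rad(T)`. -/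
def radQuotTGS (S : TernaryGammaSemiring T Γ) :
    TernaryGammaSemiring
      (congAddCon S (bourneRel (GammaRad S))
        (bourneRel_isGammaCong S _ (gammaRad_isGammaIdeal S))).Quotient Γ :=
  quotTGS S (bourneRel (GammaRad S)) (bourneRel_isGammaCong S _ (gammaRad_isGammaIdeal S))

/-- A Γ-ideal as an additive submonoid. -/
def idealSubmonoid (S : TernaryGammaSemiring T Γ) (I : Set T) (hI : IsGammaIdeal S I) :
    AddSubmonoid T where
  carrier := I
  zero_mem' := hI.1
  add_mem' := fun ha hb => hI.2.1 _ ha _ hb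

/-- The Γ-ideal `I`, as a commutative ternary Γ-semiring in its own right. -/
def idealTGS (S : TernaryGammaSemiring T Γ) (I : Set T) (hI : IsGammaIdeal S I) :
    TernaryGammaSemiring (idealSubmonoid S I hI) Γ where
  tmul := fun γ a b c => ⟨S.tmul γ a b c, hI.2.2 a b γ c c.2⟩
  distrib₁ := by intros; exact Subtype.ext (by simpa using S.distrib₁ ..)
  distrib₂ := by intros; exact Subtype.ext (by simpa using S.distrib₂ ..)
  distrib₃ := by intros; exact Subtype.ext (by simpa using S.distrib₃ ..)
  zero₁ := by intros; exact Subtype.ext (by simpa using S.zero₁ ..)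
  zero₂ := by intros; exact Subtype.ext (by simpa using S.zero₂ ..)
  zero₃ := by intros; exact Subtype.ext (by simpa using S.zero₃ ..)
  assoc := by intros; exact Subtype.ext (by simpa using S.assoc ..)
  comm₁₂ := by intros; exact Subtype.ext (by simpa using S.comm₁₂ ..)
  comm₂₃ := by intros; exact Subtype.ext (by simpa using S.comm₂₃ ..)

/-- Product of two commutative ternary Γ-semirings, with componentwise operations. -/
def prodTGS {A B : Type*} [AddCommMonoid A] [AddCommMonoid B]
    (S₁ : TernaryGammaSemiring A Γ) (S₂ : TernaryGammaSemiring B Γ) :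
    TernaryGammaSemiring (A × B) Γ where
  tmul := fun γ x y z => (S₁.tmul γ x.1 y.1 z.1, S₂.tmul γ x.2 y.2 z.2)
  distrib₁ := by intros; exact Prod.ext (S₁.distrib₁ ..) (S₂.distrib₁ ..)
  distrib₂ := by intros; exact Prod.ext (S₁.distrib₂ ..) (S₂.distrib₂ ..)
  distrib₃ := by intros; exact Prod.ext (S₁.distrib₃ ..) (S₂.distrib₃ ..)
  zero₁ := by intros; exact Prod.ext (S₁.zero₁ ..) (S₂.zero₁ ..)
  zero₂ := by intros; exact Prod.ext (S₁.zero₂ ..) (S₂.zero₂ ..)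
  zero₃ := by intros; exact Prod.ext (S₁.zero₃ ..) (S₂.zero₃ ..)
  assoc := by intros; exact Prod.ext (S₁.assoc ..) (S₂.assoc ..)
  comm₁₂ := by intros; exact Prod.ext (S₁.comm₁₂ ..) (S₂.comm₁₂ ..)
  comm₂₃ := by intros; exact Prod.ext (S₁.comm₂₃ ..) (S₂.comm₂₃ ..)

/-- The power `T^n` with componentwise addition and ternary operations. -/
def piTGS (S : TernaryGammaSemiring T Γ) (n : ℕ) :
    TernaryGammaSemiring (Fin n → T) Γ where
  tmul := fun γ x y z i => S.tmul γ (x i) (y i) (z i)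
  distrib₁ := by intros; funext i; exact S.distrib₁ ..
  distrib₂ := by intros; funext i; exact S.distrib₂ ..
  distrib₃ := by intros; funext i; exact S.distrib₃ ..
  zero₁ := by intros; funext i; exact S.zero₁ ..
  zero₂ := by intros; funext i; exact S.zero₂ ..
  zero₃ := by intros; funext i; exact S.zero₃ ..
  assoc := by intros; funext i; exact S.assoc ..
  comm₁₂ := by intros; funext i; exact S.comm₁₂ ..
  comm₂₃ := by intros; funext i; exact S.comm₂₃ ..

/-- A fuzzy Γ-ideal: a `[0,1]`-valued function `μ` with
`μ(a+b) ≥ min(μ(a), μ(b))` and `μ({x,y,a}_γ) ≥ μ(a)`. -/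
def IsFuzzyGammaIdeal (S : TernaryGammaSemiring T Γ) (μ : T → ℝ) : Prop :=
  (∀ a : T, μ a ∈ Set.Icc (0 : ℝ) 1) ∧
    (∀ a b : T, min (μ a) (μ b) ≤ μ (a + b)) ∧
    ∀ (γ : Γ) (x y a : T), μ a ≤ μ (S.tmul γ x y a)

/-- Given a family `(I_α)_{α ∈ (0,1]}` of Γ-ideals with
`I_β ⊆ I_α` whenever `α ≤ β`, the function `μ(a) = sup {α ∈ (0,1] : a ∈ I_α}`
(with `sup ∅ = 0`, as for the real `sSup`) is a fuzzy Γ-ideal. -/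
theorem chain_of_ideals_gives_fuzzy_ideal [Nonempty Γ]
    (S : TernaryGammaSemiring T Γ) (I : ℝ → Set T)
    (hIdeal : ∀ α ∈ Set.Ioc (0 : ℝ) 1, IsGammaIdeal S (I α))
    (hchain : ∀ α ∈ Set.Ioc (0 : ℝ) 1, ∀ β ∈ Set.Ioc (0 : ℝ) 1, α ≤ β → I β ⊆ I α) :
    IsFuzzyGammaIdeal S
      (fun a => sSup {α : ℝ | α ∈ Set.Ioc (0 : ℝ) 1 ∧ a ∈ I α}) := by
  have bdd (a : T) : BddAbove {α : ℝ | α ∈ Set.Ioc (0 : ℝ) 1 ∧ a ∈ I α} :=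
    ⟨1, fun α hα => hα.1.2⟩
  have nonneg (a : T) : 0 ≤ sSup {α : ℝ | α ∈ Set.Ioc (0 : ℝ) 1 ∧ a ∈ I α} :=
    Real.sSup_nonneg fun α hα => hα.1.1.le
  have exists_level (a : T) (c : ℝ) (hc : 0 ≤ c)
      (h : c < sSup {α : ℝ | α ∈ Set.Ioc (0 : ℝ) 1 ∧ a ∈ I α}) :
      ∃ α ∈ Set.Ioc (0 : ℝ) 1, a ∈ I α ∧ c < α := by
    by_contra! hle
    exact h.not_ge (Real.sSup_le (fun α hα => hle α hα.1 hα.2) hc)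
  refine ⟨fun a => ⟨nonneg a, Real.sSup_le (fun α hα => hα.1.2) zero_le_one⟩, ?_, ?_⟩
  · intro a b
    by_contra! hlt
    obtain ⟨ha, hb⟩ := lt_min_iff.1 hlt
    obtain ⟨α, hα, haα, hcα⟩ := exists_level a _ (nonneg (a + b)) ha
    obtain ⟨β, hβ, hbβ, hcβ⟩ := exists_level b _ (nonneg (a + b)) hb
    have hm : min α β ∈ Set.Ioc (0 : ℝ) 1 := ⟨lt_min hα.1 hβ.1, (min_le_left _ _).trans hα.2⟩
    have hab : a + b ∈ I (min α β) := (hIdeal _ hm).2.1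
      _ (hchain _ hm _ hα (min_le_left _ _) haα) _ (hchain _ hm _ hβ (min_le_right _ _) hbβ)
    exact (lt_min hcα hcβ).not_ge (le_csSup (bdd (a + b)) ⟨hm, hab⟩)
  · intro γ x y a
    exact Real.sSup_le
      (fun α hα => le_csSup (bdd _) ⟨hα.1, (hIdeal α hα.1).2.2 x y γ a hα.2⟩) (nonneg _)
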